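/- Let P be a finite poset and let A and B be subsets of its ground set. Then there exist a finite superposet P' of P and subsets A' ⊆ Min(P') and B' ⊆ Max(P') such that: (1) the cover graph of P' restricted to the ground set of P equals the cover graph of P, and every element of P' not in P has degree 1 in the cover graph of P'; (2) the height of P' equals the height of P; (3) B' ⊆ Up_{P'}(B) and A' ⊆ Down_{P'}(A); and (4) dim_P(A, B) ≤ dim_{P'}(A', B'). -/

import Mathlib

variable {α : Type*}

/-- A linear extension of the poset induced on ground set `s`. -/
def LinExtOn [PartialOrder α] (s : Set α) (L : α → α → Prop) : Prop :=
  (∀ x ∈ s, L x x) ∧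
  (∀ x ∈ s, ∀ y ∈ s, L x y → L y x → x = y) ∧
  (∀ x ∈ s, ∀ y ∈ s, ∀ z ∈ s, L x y → L y z → L x z) ∧
  (∀ x ∈ s, ∀ y ∈ s, L x y ∨ L y x) ∧
  (∀ x ∈ s, ∀ y ∈ s, x ≤ y → L x y)

/-- The set of incomparable pairs of the poset induced on ground set `s`. -/
def IncOn [PartialOrder α] (s : Set α) : Set (α × α) :=
  {p | p.1 ∈ s ∧ p.2 ∈ s ∧ ¬ p.1 ≤ p.2 ∧ ¬ p.2 ≤ p.1}

/-- `I` is reversible in the poset induced on `s`. -/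
def ReversibleOn [PartialOrder α] (s : Set α) (I : Set (α × α)) : Prop :=
  ∃ L, LinExtOn s L ∧ ∀ p ∈ I, L p.2 p.1 ∧ ¬ L p.1 p.2

/-- `dim_s(I)`: least `d` such that `I` can be partitioned into `d` reversible sets. -/
noncomputable def dimOn [PartialOrder α] (s : Set α) (I : Set (α × α)) : ℕ :=
  sInf {d | ∃ J : Fin d → Set (α × α), (⋃ i, J i) = I ∧
    (Pairwise fun i j => Disjoint (J i) (J j)) ∧ ∀ i, ReversibleOn s (J i)}

/-- `dim_s(A, B)`. -/
noncomputable def dimAB [PartialOrder α] (s A B : Set α) : ℕ :=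
  dimOn s (IncOn s ∩ A ×ˢ B)

/-- Minimal elements of the poset induced on `s`. -/
def MinOn [PartialOrder α] (s : Set α) : Set α := {x | x ∈ s ∧ ∀ y ∈ s, y ≤ x → y = x}

/-- Maximal elements of the poset induced on `s`. -/
def MaxOn [PartialOrder α] (s : Set α) : Set α := {x | x ∈ s ∧ ∀ y ∈ s, x ≤ y → y = x}

/-- Up_P(S). -/
def UpSet [PartialOrder α] (S : Set α) : Set α := {y | ∃ x ∈ S, x ≤ y}

/-- Down_P(S). -/
def DownSet [PartialOrder α] (S : Set α) : Set α := {x | ∃ y ∈ S, x ≤ y}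

/-- The cover graph of a poset. -/
def coverGraph (α : Type*) [PartialOrder α] : SimpleGraph α :=
  SimpleGraph.fromRel (· ⋖ ·)

/-- The cover graph of the subposet induced on ground set `s`
(as a graph on the ambient type; vertices outside `s` are isolated). -/
def coverGraphOn [PartialOrder α] (s : Set α) : SimpleGraph α :=
  SimpleGraph.fromRel (fun x y => x ∈ s ∧ y ∈ s ∧ x < y ∧ ¬ ∃ z ∈ s, x < z ∧ z < y)

/-- The dimension of a poset: least size of a nonempty family of linear extensions
whose intersection is the partial order. -/
noncomputable def posetDim (α : Type*) [PartialOrder α] : ℕ :=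
  sInf {d | 0 < d ∧ ∃ L : Fin d → (α → α → Prop),
    (∀ i, LinExtOn Set.univ (L i)) ∧ ∀ x y : α, x ≤ y ↔ ∀ i, L i x y}

/-- The height of a poset: maximum size of a chain. -/
noncomputable def posetHeight (α : Type*) [PartialOrder α] : ℕ :=
  sSup {n | ∃ l : List α, l.Chain' (· < ·) ∧ l.length = n}

/-- A pair of incomparable elements can be reversed by a linear extension. -/
theorem reversibleOn_singleton [PartialOrder α] {p : α × α} (hp : p ∈ IncOn (Set.univ : Set α)) :
    ReversibleOn Set.univ {p} := by
  obtain ⟨a, b⟩ := p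
  obtain ⟨-, -, hab, hba⟩ := hp
  let r : α → α → Prop := fun x y => x ≤ y ∨ (x ≤ b ∧ a ≤ y)
  have : IsPartialOrder α r :=
    { refl := fun x => Or.inl le_rfl
      trans := by
        rintro x y z (h | ⟨h, h'⟩) (k | ⟨k, k'⟩)
        · exact Or.inl (h.trans k)
        · exact Or.inr ⟨h.trans k, k'⟩
        · exact Or.inr ⟨h, h'.trans k⟩
        · exact Or.inr ⟨h, k'⟩
      antisymm := by
        rintro x y (h | ⟨h, h'⟩) (k | ⟨k, k'⟩)
        · exact le_antisymm h k
        · exact absurd (k'.trans (h.trans k)) hab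
        · exact absurd (h'.trans (k.trans h)) hab
        · exact absurd (h'.trans k) hab }
  obtain ⟨s, hs, hrs⟩ := extend_partialOrder r
  have hsba : s b a := hrs _ _ (Or.inr ⟨le_rfl, le_rfl⟩)
  refine ⟨s, ⟨fun x _ => refl_of s x, fun x _ y _ h k => antisymm_of s h k,
    fun x _ y _ z _ h k => trans_of s h k, fun x _ y _ => total_of s x y,
    fun x _ y _ h => hrs _ _ (Or.inl h)⟩, ?_⟩
  rintro _ rfl
  exact ⟨hsba, fun h => hab (antisymm_of s h hsba).le⟩

theorem exists_partition_reversibleOn [PartialOrder α] [Finite α] {I : Set (α × α)}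
    (hI : I ⊆ IncOn Set.univ) :
    {d | ∃ J : Fin d → Set (α × α), (⋃ i, J i) = I ∧
      (Pairwise fun i j => Disjoint (J i) (J j)) ∧
      ∀ i, ReversibleOn Set.univ (J i)}.Nonempty := by
  let e := Finite.equivFin I
  refine ⟨Nat.card I, fun k => {(e.symm k : α × α)}, ?_, ?_, ?_⟩
  · ext p
    simp only [Set.mem_iUnion, Set.mem_singleton_iff]
    exact ⟨fun ⟨k, hk⟩ => hk ▸ (e.symm k).2, fun hp => ⟨e ⟨p, hp⟩, by rw [e.symm_apply_apply]⟩⟩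
  · intro k l hkl
    exact Set.disjoint_singleton.2 fun h => hkl (e.symm.injective (Subtype.coe_injective h))
  · exact fun k => reversibleOn_singleton (hI (e.symm k).2)

theorem ReversibleOn.comap {β : Type*} [PartialOrder α] [PartialOrder β] (i : α ↪o β)
    {f g : α → β} (hf : ∀ a, f a ≤ i a) (hg : ∀ b, i b ≤ g b)
    {I : Set (α × α)} {I' : Set (β × β)} (hI : ∀ p ∈ I, (f p.1, g p.2) ∈ I')
    (h : ReversibleOn Set.univ I') : ReversibleOn Set.univ I := by
  obtain ⟨L, ⟨hrefl, hanti, htrans, htotal, hle⟩, hrev⟩ := h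
  simp only [Set.mem_univ, forall_true_left] at hrefl hanti htrans htotal hle
  refine ⟨fun x y => L (i x) (i y), ⟨fun x _ => hrefl _,
    fun x _ y _ h k => i.injective (hanti _ _ h k), fun x _ y _ z _ => htrans _ _ _,
    fun x _ y _ => htotal _ _, fun x _ y _ h => hle _ _ (i.monotone h)⟩, ?_⟩
  rintro ⟨a, b⟩ hab
  obtain ⟨h1, h2⟩ := hrev _ (hI _ hab)
  exact ⟨htrans _ _ _ (hle _ _ (hg b)) (htrans _ _ _ h1 (hle _ _ (hf a))),
    fun h => h2 (htrans _ _ _ (hle _ _ (hf a)) (htrans _ _ _ h (hle _ _ (hg b))))⟩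

theorem dimOn_le_dimOn_of_map {β : Type*} [PartialOrder α] [PartialOrder β] [Finite β]
    (i : α ↪o β) {f g : α → β} (hf : ∀ a, f a ≤ i a) (hg : ∀ b, i b ≤ g b)
    {I : Set (α × α)} {I' : Set (β × β)} (hI : ∀ p ∈ I, (f p.1, g p.2) ∈ I')
    (hI' : I' ⊆ IncOn Set.univ) :
    dimOn Set.univ I ≤ dimOn Set.univ I' := by
  obtain ⟨J, hJ, hdisj, hrev⟩ := Nat.sInf_mem (exists_partition_reversibleOn hI')
  refine Nat.sInf_le ⟨fun k => {p | p ∈ I ∧ (f p.1, g p.2) ∈ J k}, ?_, ?_, ?_⟩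
  · ext p
    simp only [Set.mem_iUnion, Set.mem_ofPred_eq]
    refine ⟨fun ⟨_, hp, _⟩ => hp, fun hp => ?_⟩
    obtain ⟨k, hk⟩ := Set.mem_iUnion.1 (hJ.symm ▸ hI p hp)
    exact ⟨k, hp, hk⟩
  · intro k l hkl
    exact Set.disjoint_left.2 fun p hp hp' =>
      Set.disjoint_left.1 (hdisj hkl) hp.2 hp'.2
  · exact fun k => (hrev k).comap i hf hg fun p hp => hp.2

theorem posetHeight_eq_of_strictMono {β : Type*} [PartialOrder α] [PartialOrder β]
    {f : α → β} {g : β → α} (hf : StrictMono f) (hg : StrictMono g) :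
    posetHeight β = posetHeight α := by
  unfold posetHeight
  congr 1
  ext n
  constructor
  · rintro ⟨l, hl, rfl⟩
    exact ⟨l.map g, List.isChain_map_of_isChain g (fun _ _ h => hg h) hl, by simp⟩
  · rintro ⟨l, hl, rfl⟩
    exact ⟨l.map f, List.isChain_map_of_isChain f (fun _ _ h => hf h) hl, by simp⟩

/-- The poset `α` with a new element attached below every non-minimal element and a new element
attached above every non-maximal element. -/
inductive PendantExt (α : Type*) [PartialOrder α]
  | base (x : α)
  | low (x : α) (h : ¬ IsMin x)
  | high (x : α) (h : ¬ IsMax x)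

namespace PendantExt

variable [PartialOrder α]

/-- The order of `PendantExt α`. -/
def Le : PendantExt α → PendantExt α → Prop
  | base x, base y => x ≤ y
  | base x, high y _ => x ≤ y
  | low x _, base y => x ≤ y
  | low x _, high y _ => x ≤ y
  | low x _, low y _ => x = y
  | high x _, high y _ => x = y
  | base _, low _ _ => False
  | high _ _, base _ => False
  | high _ _, low _ _ => False

instance : PartialOrder (PendantExt α) where
  le := Le
  le_refl p := by cases p <;> simp [Le]
  le_trans p q r := by
    cases p <;> cases q <;> cases r <;> simp only [Le] <;> grind
  le_antisymm p q := by
    cases p <;> cases q <;> simp only [Le] <;> grind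

section

variable {x y : α} {hx : ¬ IsMin x} {hy : ¬ IsMin y} {kx : ¬ IsMax x} {ky : ¬ IsMax y}

@[simp] theorem base_le_base : base x ≤ base y ↔ x ≤ y := Iff.rfl
@[simp] theorem base_le_high : base x ≤ high y ky ↔ x ≤ y := Iff.rfl
@[simp] theorem low_le_base : low x hx ≤ base y ↔ x ≤ y := Iff.rfl
@[simp] theorem low_le_high : low x hx ≤ high y ky ↔ x ≤ y := Iff.rfl
@[simp] theorem low_le_low : low x hx ≤ low y hy ↔ x = y := Iff.rfl
@[simp] theorem high_le_high : high x kx ≤ high y ky ↔ x = y := Iff.rfl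
@[simp] theorem not_base_le_low : ¬ base x ≤ low y hy := id
@[simp] theorem not_high_le_base : ¬ high x kx ≤ base y := id
@[simp] theorem not_high_le_low : ¬ high x kx ≤ low y hy := id

end

instance [Finite α] : Finite (PendantExt α) :=
  Finite.of_injective (β := α ⊕ α ⊕ α)
    (fun
      | base x => .inl x
      | low x _ => .inr (.inl x)
      | high x _ => .inr (.inr x))
    (by intro p q; cases p <;> cases q <;> simp)

/-- The embedding of `α` into `PendantExt α`. -/
def baseEmb : α ↪o PendantExt α where
  toFun := base
  inj' _ _ h := by cases h; rfl
  map_rel_iff' := Iff.rfl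

@[simp] theorem baseEmb_apply (x : α) : baseEmb x = base x := rfl

theorem isMin_low (x : α) (h : ¬ IsMin x) : IsMin (low x h) := by
  intro q; cases q <;> simp +contextual

theorem isMax_high (x : α) (h : ¬ IsMax x) : IsMax (high x h) := by
  intro q; cases q <;> simp +contextual

theorem base_le_of_low_lt {x : α} {h : ¬ IsMin x} {q : PendantExt α} (hq : low x h < q) :
    base x ≤ q := by
  cases q with
  | low y hy => exact absurd hq (isMin_low y hy).not_lt
  | _ => exact hq.le

theorem le_base_of_lt_high {x : α} {h : ¬ IsMax x} {q : PendantExt α} (hq : q < high x h) :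
    q ≤ base x := by
  cases q with
  | high y hy => exact absurd hq (isMax_high y hy).not_lt
  | _ => exact hq.le

theorem low_lt_base (x : α) (h : ¬ IsMin x) : low x h < base x := by
  simp [lt_iff_le_not_ge]

theorem base_lt_high (x : α) (h : ¬ IsMax x) : base x < high x h := by
  simp [lt_iff_le_not_ge]

theorem base_covBy_base {x y : α} : base x ⋖ base y ↔ x ⋖ y := by
  refine ⟨fun h => CovBy.of_image baseEmb h, fun h => ⟨baseEmb.strictMono h.1, ?_⟩⟩
  intro q hq hq'
  cases q with
  | base z => exact h.2 (baseEmb.lt_iff_lt.1 hq) (baseEmb.lt_iff_lt.1 hq')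
  | low z hz => exact not_base_le_low hq.le
  | high z hz => exact not_high_le_base hq'.le

theorem low_covBy_iff {x : α} {h : ¬ IsMin x} {q : PendantExt α} :
    low x h ⋖ q ↔ q = base x := by
  constructor
  · intro hq
    by_contra hne
    exact hq.2 (low_lt_base x h) (lt_of_le_of_ne (base_le_of_low_lt hq.1) (Ne.symm hne))
  · rintro rfl
    exact ⟨low_lt_base x h, fun c hc hc' => (base_le_of_low_lt hc).not_gt hc'⟩

theorem covBy_high_iff {x : α} {h : ¬ IsMax x} {q : PendantExt α} :
    q ⋖ high x h ↔ q = base x := by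
  constructor
  · intro hq
    by_contra hne
    exact hq.2 (lt_of_le_of_ne (le_base_of_lt_high hq.1) hne) (base_lt_high x h)
  · rintro rfl
    exact ⟨base_lt_high x h, fun c hc hc' => (le_base_of_lt_high hc').not_gt hc⟩

theorem coverGraph_adj_base {x y : α} :
    (coverGraph (PendantExt α)).Adj (base x) (base y) ↔ (coverGraph α).Adj x y := by
  simp [coverGraph, SimpleGraph.fromRel_adj, base_covBy_base]

theorem coverGraph_adj_low {x : α} {h : ¬ IsMin x} {q : PendantExt α} :
    (coverGraph (PendantExt α)).Adj (low x h) q ↔ q = base x := by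
  have hq : ¬ q ⋖ low x h := fun hq => (isMin_low x h).not_lt hq.1
  simp only [coverGraph, SimpleGraph.fromRel_adj, low_covBy_iff, hq, or_false]
  exact ⟨fun h => h.2, fun h => ⟨by simp [h], h⟩⟩

theorem coverGraph_adj_high {x : α} {h : ¬ IsMax x} {q : PendantExt α} :
    (coverGraph (PendantExt α)).Adj (high x h) q ↔ q = base x := by
  have hq : ¬ high x h ⋖ q := fun hq => (isMax_high x h).not_lt hq.1
  simp only [coverGraph, SimpleGraph.fromRel_adj, covBy_high_iff, hq, false_or]
  exact ⟨fun h => h.2, fun h => ⟨by simp [h], h⟩⟩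

theorem exists_strictMono : ∃ f : PendantExt α → α, StrictMono f := by
  have hlow : ∀ x : α, ¬ IsMin x → ∃ y, y < x := fun x hx => not_isMin_iff.1 hx
  have hhigh : ∀ x : α, ¬ IsMax x → ∃ y, x < y := fun x hx => not_isMax_iff.1 hx
  choose l hl using hlow
  choose u hu using hhigh
  refine ⟨fun
    | base x => x
    | low x h => l x h
    | high x h => u x h, ?_⟩
  intro p q hpq
  cases p with
  | base x =>
    cases q with
    | base y => exact baseEmb.lt_iff_lt.1 hpq
    | low y hy => exact absurd hpq.le not_base_le_low
    | high y hy => exact (base_le_high.1 hpq.le).trans_lt (hu y hy)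
  | low x hx =>
    cases q with
    | base y => exact (hl x hx).trans_le (low_le_base.1 hpq.le)
    | low y hy => exact absurd hpq (isMin_low y hy).not_lt
    | high y hy => exact ((hl x hx).trans_le (low_le_high.1 hpq.le)).trans (hu y hy)
  | high x hx => exact absurd hpq (isMax_high x hx).not_lt

open Classical in
/-- The minimal element of `PendantExt α` attached to `x`. -/
noncomputable def toMin (x : α) : PendantExt α :=
  if h : IsMin x then base x else low x h

open Classical in
/-- The maximal element of `PendantExt α` attached to `x`. -/
noncomputable def toMax (x : α) : PendantExt α :=
  if h : IsMax x then base x else high x h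

theorem toMin_le_base (x : α) : toMin x ≤ base x := by
  unfold toMin; split_ifs <;> simp

theorem base_le_toMax (x : α) : base x ≤ toMax x := by
  unfold toMax; split_ifs <;> simp

theorem isMin_toMin (x : α) : IsMin (toMin x) := by
  unfold toMin
  split_ifs with h
  · intro q hq
    cases q with
    | base y => exact h hq
    | low y hy => exact absurd (h.mono (low_le_base.1 hq)) hy
    | high y hy => exact absurd hq not_high_le_base
  · exact isMin_low x h

theorem isMax_toMax (x : α) : IsMax (toMax x) := by
  unfold toMax
  split_ifs with h
  · intro q hq
    cases q with
    | base y => exact h hq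
    | low y hy => exact absurd hq not_base_le_low
    | high y hy => exact absurd (h.mono (base_le_high.1 hq)) hy
  · exact isMax_high x h

theorem toMin_le_toMax {x y : α} : toMin x ≤ toMax y ↔ x ≤ y := by
  unfold toMin toMax; split_ifs <;> simp

theorem le_of_toMax_le_toMin {x y : α} (h : toMax x ≤ toMin y) : x ≤ y :=
  base_le_base.1 ((base_le_toMax x).trans (h.trans (toMin_le_base y)))

end PendantExt

universe u

open PendantExt in
/-- For a finite poset `P` and subsets `A`, `B` of its ground set there is
a finite superposet `P'` (given by an order embedding `i : P ↪o P'`) and subsets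
`A' ⊆ Min(P')`, `B' ⊆ Max(P')` such that: the cover graph of `P'` restricted to `P`
equals the cover graph of `P` and every new element has degree 1; the heights agree;
`B' ⊆ Up_{P'}(B)` and `A' ⊆ Down_{P'}(A)`; and `dim_P(A,B) ≤ dim_{P'}(A',B')`. -/
theorem stmt_3 (α : Type u) [PartialOrder α] [Fintype α] (A B : Set α) :
    ∃ (β : Type u) (_ : PartialOrder β) (_ : Fintype β) (i : α ↪o β) (A' B' : Set β),
      A' ⊆ MinOn (Set.univ : Set β) ∧ B' ⊆ MaxOn (Set.univ : Set β) ∧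
      ((∀ x y : α, (coverGraph β).Adj (i x) (i y) ↔ (coverGraph α).Adj x y) ∧
        (∀ b : β, b ∉ Set.range i → ∃! c : β, (coverGraph β).Adj b c)) ∧
      posetHeight β = posetHeight α ∧
      (B' ⊆ UpSet (i '' B) ∧ A' ⊆ DownSet (i '' A)) ∧
      dimAB (Set.univ : Set α) A B ≤ dimAB (Set.univ : Set β) A' B' := by
  refine ⟨PendantExt α, inferInstance, Fintype.ofFinite _, baseEmb, toMin '' A, toMax '' B,
    ?_, ?_, ⟨fun x y => coverGraph_adj_base, ?_⟩, ?_, ⟨?_, ?_⟩, ?_⟩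
  · rintro _ ⟨a, -, rfl⟩
    exact ⟨trivial, fun q _ hq => (isMin_toMin a).eq_of_le hq⟩
  · rintro _ ⟨b, -, rfl⟩
    exact ⟨trivial, fun q _ hq => ((isMax_toMax b).eq_of_le hq).symm⟩
  · intro q hq
    cases q with
    | base x => exact absurd ⟨x, rfl⟩ hq
    | low x h => exact ⟨base x, coverGraph_adj_low.2 rfl, fun _ => coverGraph_adj_low.1⟩
    | high x h => exact ⟨base x, coverGraph_adj_high.2 rfl, fun _ => coverGraph_adj_high.1⟩
  · obtain ⟨g, hg⟩ := exists_strictMono (α := α)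
    exact posetHeight_eq_of_strictMono baseEmb.strictMono hg
  · rintro _ ⟨b, hb, rfl⟩
    exact ⟨base b, ⟨b, hb, rfl⟩, base_le_toMax b⟩
  · rintro _ ⟨a, ha, rfl⟩
    exact ⟨base a, ⟨a, ha, rfl⟩, toMin_le_base a⟩
  · refine dimOn_le_dimOn_of_map baseEmb toMin_le_base base_le_toMax ?_ Set.inter_subset_left
    rintro ⟨a, b⟩ ⟨⟨-, -, hab, hba⟩, ha, hb⟩
    exact ⟨⟨trivial, trivial, fun h => hab (toMin_le_toMax.1 h),
      fun h => hba (le_of_toMax_le_toMin h)⟩, ⟨a, ha, rfl⟩, ⟨b, hb, rfl⟩⟩
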